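/- (The two regular nilpotent orbits are distinct) Both ξ_+ and ξ_− lie in the nilpotent cone 𝒩 and are regular (Δ_+(ξ_+) = 1 and Δ_−(ξ_−) is a unit), but they are not in the same GL_n(F)-orbit: there is no h ∈ GL_n(F) with h·ξ_+ = ξ_−. -/

import Mathlib

open Matrix MeasureTheory

namespace ZhangRTF

variable {F : Type*} [Field F] {n : ℕ}

/-- Block diagonal embedding `diag(h,1) ∈ M_{n+1}(F)` of `h ∈ M_n(F)`. -/
def emb (h : Matrix (Fin n) (Fin n) F) : Matrix (Fin (n + 1)) (Fin (n + 1)) F :=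
  Matrix.of fun i j =>
    if hi : (i : ℕ) < n then
      (if hj : (j : ℕ) < n then h ⟨i, hi⟩ ⟨j, hj⟩ else 0)
    else (if (j : ℕ) < n then 0 else 1)

/-- Conjugation action of `GL_n(F)` on `M_{n+1}(F)`: `h·X = diag(h,1) X diag(h,1)⁻¹`. -/
def act (h : Matrix.GeneralLinearGroup (Fin n) F)
    (X : Matrix (Fin (n + 1)) (Fin (n + 1)) F) : Matrix (Fin (n + 1)) (Fin (n + 1)) F :=
  emb (h : Matrix (Fin n) (Fin n) F) * X *
    emb ((h⁻¹ : Matrix.GeneralLinearGroup (Fin n) F) : Matrix (Fin n) (Fin n) F)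

/-- The upper-left `n × n` block `A` of `X = [[A,u],[v,w]]`. -/
def blockA (X : Matrix (Fin (n + 1)) (Fin (n + 1)) F) : Matrix (Fin n) (Fin n) F :=
  Matrix.of fun i j => X i.castSucc j.castSucc

/-- The upper-right column `u` of `X = [[A,u],[v,w]]`. -/
def blockU (X : Matrix (Fin (n + 1)) (Fin (n + 1)) F) : Fin n → F :=
  fun i => X i.castSucc (Fin.last n)

/-- The lower-left row `v` of `X = [[A,u],[v,w]]`. -/
def blockV (X : Matrix (Fin (n + 1)) (Fin (n + 1)) F) : Fin n → F :=
  fun j => X (Fin.last n) j.castSucc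

/-- The lower-right corner `w` of `X = [[A,u],[v,w]]`. -/
def blockW (X : Matrix (Fin (n + 1)) (Fin (n + 1)) F) : F :=
  X (Fin.last n) (Fin.last n)

/-- `δ₊(X)`: the matrix whose `j`-th column is `A^{n-j} u` (`1 ≤ j ≤ n`, 1-indexed). -/
def deltaPlus (X : Matrix (Fin (n + 1)) (Fin (n + 1)) F) : Matrix (Fin n) (Fin n) F :=
  Matrix.of fun i j => (blockA X ^ (n - 1 - (j : ℕ)) *ᵥ blockU X) i

/-- `δ₋(X)`: the matrix whose `i`-th row is `v A^{i-1}` (`1 ≤ i ≤ n`, 1-indexed). -/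
def deltaMinus (X : Matrix (Fin (n + 1)) (Fin (n + 1)) F) : Matrix (Fin n) (Fin n) F :=
  Matrix.of fun i j => (blockV X ᵥ* blockA X ^ (i : ℕ)) j

/-- `Δ₊(X) = det δ₊(X)`. -/
def DeltaPlus (X : Matrix (Fin (n + 1)) (Fin (n + 1)) F) : F := (deltaPlus X).det

/-- `Δ₋(X) = det δ₋(X)`. -/
def DeltaMinus (X : Matrix (Fin (n + 1)) (Fin (n + 1)) F) : F := (deltaMinus X).det

/-- The `a`-invariants: `a_i = -(coefficient of T^{n-i} in charpoly A)` (1-indexed). -/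
noncomputable def aInv (X : Matrix (Fin (n + 1)) (Fin (n + 1)) F) : Fin n → F :=
  fun i => -((blockA X).charpoly.coeff (n - 1 - (i : ℕ)))

/-- The `b`-invariants: `b_0 = w` and `b_j = v A^{j-1} u` for `1 ≤ j ≤ n`. -/
def bInv (X : Matrix (Fin (n + 1)) (Fin (n + 1)) F) : Fin (n + 1) → F :=
  fun j => if (j : ℕ) = 0 then blockW X
    else blockV X ⬝ᵥ (blockA X ^ ((j : ℕ) - 1) *ᵥ blockU X)

/-- The invariants map `π : M_{n+1}(F) → F^n × F^{n+1}`. -/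
noncomputable def invMap (X : Matrix (Fin (n + 1)) (Fin (n + 1)) F) : (Fin n → F) × (Fin (n + 1) → F) :=
  (aInv X, bInv X)

/-- The regular nilpotent `ξ₊`: `(i,i+1)`-entries equal to `1`, all others `0`. -/
def xiPlus (n : ℕ) : Matrix (Fin (n + 1)) (Fin (n + 1)) F :=
  Matrix.of fun i j => if (j : ℕ) = (i : ℕ) + 1 then 1 else 0

/-- The section `σ(a,b)` of the invariants map. -/
def sectSigma (a : Fin n → F) (b : Fin (n + 1) → F) : Matrix (Fin (n + 1)) (Fin (n + 1)) F :=
  Matrix.of fun i j =>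
    if hi : (i : ℕ) < n then
      (if (j : ℕ) = 0 then a ⟨i, hi⟩ else 0) + (if (j : ℕ) = (i : ℕ) + 1 then 1 else 0)
    else b j.rev

/-- The variant section `σ'(a,b)`. -/
def sectSigma' (a : Fin n → F) (b : Fin (n + 1) → F) : Matrix (Fin (n + 1)) (Fin (n + 1)) F :=
  Matrix.of fun i j =>
    if (i : ℕ) < n - 1 then (if (j : ℕ) = (i : ℕ) + 1 then 1 else 0)
    else if (i : ℕ) = n - 1 then
      (if hj : (j : ℕ) < n then a ⟨n - 1 - (j : ℕ), by omega⟩ else 1)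
    else b j.rev

/-- Membership in `N_{n,-}`: lower triangular with unit diagonal. -/
def IsLowerUni (h : Matrix (Fin n) (Fin n) F) : Prop :=
  (∀ i, h i i = 1) ∧ ∀ i j : Fin n, i < j → h i j = 0

/-- Membership in `N_n`: upper triangular with unit diagonal. -/
def IsUpperUni (h : Matrix (Fin n) (Fin n) F) : Prop :=
  (∀ i, h i i = 1) ∧ ∀ i j : Fin n, j < i → h i j = 0

/-- Membership in the subvariety `𝒲`: superdiagonal entries `1`,
entries above the superdiagonal `0`. -/
def memW (X : Matrix (Fin (n + 1)) (Fin (n + 1)) F) : Prop :=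
  ∀ i j : Fin (n + 1),
    ((j : ℕ) = (i : ℕ) + 1 → X i j = 1) ∧ ((i : ℕ) + 1 < (j : ℕ) → X i j = 0)

/-- `p : 𝒲 → 𝒱`, replacing the last row by zero. -/
def pMap (X : Matrix (Fin (n + 1)) (Fin (n + 1)) F) : Matrix (Fin (n + 1)) (Fin (n + 1)) F :=
  Matrix.of fun i j => if (i : ℕ) = n then 0 else X i j

/-- `p' : 𝒲 → 𝒱'`, replacing the last row and the first column by zero. -/
def pMap' (X : Matrix (Fin (n + 1)) (Fin (n + 1)) F) : Matrix (Fin (n + 1)) (Fin (n + 1)) F :=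
  Matrix.of fun i j => if (i : ℕ) = n ∨ (j : ℕ) = 0 then 0 else X i j

/-- The determinant of an element of `GL_n(F)`, as a unit of `F`. -/
def GLdet (h : Matrix.GeneralLinearGroup (Fin n) F) : Fˣ :=
  Units.map Matrix.detMonoidHom h

end ZhangRTF

open ZhangRTF


section Helpers

variable {F : Type*} [Field F] {n : ℕ}

lemma emb_cc (h : Matrix (Fin n) (Fin n) F) (i j : Fin n) :
    emb h i.castSucc j.castSucc = h i j := by
  simp [emb]

lemma emb_cl (h : Matrix (Fin n) (Fin n) F) (i : Fin n) :
    emb h i.castSucc (Fin.last n) = 0 := by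
  simp [emb]

lemma emb_lc (h : Matrix (Fin n) (Fin n) F) (j : Fin n) :
    emb h (Fin.last n) j.castSucc = 0 := by
  simp [emb]

lemma emb_ll (h : Matrix (Fin n) (Fin n) F) :
    emb h (Fin.last n) (Fin.last n) = 1 := by
  simp [emb]

lemma emb_mul_inv (h : Matrix.GeneralLinearGroup (Fin n) F) :
    emb ((h⁻¹ : Matrix.GeneralLinearGroup (Fin n) F) : Matrix (Fin n) (Fin n) F) *
      emb (h : Matrix (Fin n) (Fin n) F) = 1 := by
  have hh : ((h⁻¹ : Matrix.GeneralLinearGroup (Fin n) F) : Matrix (Fin n) (Fin n) F) *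
      (h : Matrix (Fin n) (Fin n) F) = 1 := Units.inv_mul h
  ext i j
  rw [Matrix.mul_apply, Fin.sum_univ_castSucc]
  induction i using Fin.lastCases with
  | last =>
    induction j using Fin.lastCases with
    | last => simp only [emb_lc, emb_cl, emb_ll]; simp
    | cast j =>
      simp only [emb_lc, emb_cc, emb_ll]
      rw [Matrix.one_apply_ne (Fin.castSucc_lt_last j).ne']; simp
  | cast i =>
    induction j using Fin.lastCases with
    | last =>
      simp only [emb_cc, emb_cl, emb_ll]
      rw [Matrix.one_apply_ne (Fin.castSucc_lt_last i).ne]; simp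
    | cast j =>
      simp only [emb_cc, emb_cl, emb_lc]
      rw [← Matrix.mul_apply, hh]
      simp [Matrix.one_apply]

lemma act_comm {h : Matrix.GeneralLinearGroup (Fin n) F}
    {X Y : Matrix (Fin (n + 1)) (Fin (n + 1)) F} (e : act h X = Y) :
    emb (h : Matrix (Fin n) (Fin n) F) * X = Y * emb (h : Matrix (Fin n) (Fin n) F) := by
  rw [← e, act, Matrix.mul_assoc, emb_mul_inv, Matrix.mul_one]

lemma act_A {h : Matrix.GeneralLinearGroup (Fin n) F}
    {X Y : Matrix (Fin (n + 1)) (Fin (n + 1)) F} (e : act h X = Y) :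
    (h : Matrix (Fin n) (Fin n) F) * blockA X = blockA Y * (h : Matrix (Fin n) (Fin n) F) := by
  ext i j
  have := congrFun (congrFun (act_comm e) i.castSucc) j.castSucc
  simpa [Matrix.mul_apply, Fin.sum_univ_castSucc, emb_cc, emb_cl, emb_lc, emb_ll, blockA]
    using this

lemma act_U {h : Matrix.GeneralLinearGroup (Fin n) F}
    {X Y : Matrix (Fin (n + 1)) (Fin (n + 1)) F} (e : act h X = Y) :
    (h : Matrix (Fin n) (Fin n) F) *ᵥ blockU X = blockU Y := by
  ext i
  have := congrFun (congrFun (act_comm e) i.castSucc) (Fin.last n)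
  simpa [Matrix.mul_apply, Fin.sum_univ_castSucc, emb_cc, emb_cl, emb_lc, emb_ll, blockU,
    Matrix.mulVec, dotProduct] using this

lemma act_V {h : Matrix.GeneralLinearGroup (Fin n) F}
    {X Y : Matrix (Fin (n + 1)) (Fin (n + 1)) F} (e : act h X = Y) :
    blockV Y ᵥ* (h : Matrix (Fin n) (Fin n) F) = blockV X := by
  ext i
  have := congrFun (congrFun (act_comm e) (Fin.last n)) i.castSucc
  simpa [Matrix.mul_apply, Fin.sum_univ_castSucc, emb_cc, emb_cl, emb_lc, emb_ll, blockV,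
    Matrix.vecMul, dotProduct] using this.symm

lemma blockA_transpose (X : Matrix (Fin (n + 1)) (Fin (n + 1)) F) :
    blockA Xᵀ = (blockA X)ᵀ := rfl

lemma blockU_transpose (X : Matrix (Fin (n + 1)) (Fin (n + 1)) F) :
    blockU Xᵀ = blockV X := rfl

lemma blockV_transpose (X : Matrix (Fin (n + 1)) (Fin (n + 1)) F) :
    blockV Xᵀ = blockU X := rfl

lemma blockV_xi : blockV (xiPlus n : Matrix (Fin (n + 1)) (Fin (n + 1)) F) = 0 := by
  ext j
  have := j.2
  simp only [blockV, xiPlus, Matrix.of_apply, Fin.val_castSucc, Fin.val_last, Pi.zero_apply]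
  rw [if_neg (by omega)]

lemma blockW_xi : blockW (xiPlus n : Matrix (Fin (n + 1)) (Fin (n + 1)) F) = 0 := by
  simp [blockW, xiPlus]

lemma pow_xi (k : ℕ) (i : Fin n) :
    (blockA (xiPlus n : Matrix (Fin (n + 1)) (Fin (n + 1)) F) ^ k *ᵥ blockU (xiPlus n)) i
      = if (i : ℕ) + k + 1 = n then 1 else 0 := by
  induction k generalizing i with
  | zero =>
    simp only [pow_zero, Matrix.one_mulVec, blockU, xiPlus, Matrix.of_apply, Fin.val_castSucc,
      Fin.val_last]
    congr 1
    exact propext ⟨fun h => by omega, fun h => by omega⟩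
  | succ k ih =>
    rw [pow_succ', ← Matrix.mulVec_mulVec, Matrix.mulVec, dotProduct]
    simp only [ih]
    simp only [blockA, xiPlus, Matrix.of_apply, Fin.val_castSucc]
    by_cases hi : (i : ℕ) + 1 < n
    · rw [Finset.sum_eq_single (⟨i + 1, hi⟩ : Fin n)]
      · simp only [if_true, one_mul]
        congr 1
        exact propext ⟨fun h => by omega, fun h => by omega⟩
      · intro b _ hb
        rw [if_neg, zero_mul]
        intro hb'
        exact hb (Fin.ext hb')
      · simp
    · rw [if_neg (by omega)]
      apply Finset.sum_eq_zero
      intro b _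
      have := b.2
      rw [if_neg (by omega), zero_mul]

lemma charpoly_xi :
    (blockA (xiPlus n : Matrix (Fin (n + 1)) (Fin (n + 1)) F)).charpoly = Polynomial.X ^ n := by
  rw [Matrix.charpoly_of_upperTriangular]
  · simp [blockA, xiPlus]
  · intro i j hij
    have : (j : ℕ) < i := hij
    simp only [blockA, xiPlus, Matrix.of_apply, Fin.val_castSucc]
    rw [if_neg (by omega)]

lemma deltaPlus_xi : deltaPlus (xiPlus n : Matrix (Fin (n + 1)) (Fin (n + 1)) F) = 1 := by
  ext i j
  rw [deltaPlus, Matrix.of_apply, pow_xi, Matrix.one_apply]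
  have := i.2
  have := j.2
  congr 1
  exact propext ⟨fun h => Fin.ext (by omega), fun h => by subst h; omega⟩

lemma deltaMinus_xi (i j : Fin n) :
    deltaMinus (xiPlus n : Matrix (Fin (n + 1)) (Fin (n + 1)) F)ᵀ i j =
      if (j : ℕ) + i + 1 = n then 1 else 0 := by
  rw [deltaMinus, Matrix.of_apply, blockV_transpose, blockA_transpose, ← Matrix.transpose_pow,
    Matrix.vecMul_transpose, pow_xi]

lemma deltaMinus_sq :
    deltaMinus (xiPlus n : Matrix (Fin (n + 1)) (Fin (n + 1)) F)ᵀ *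
      deltaMinus (xiPlus n : Matrix (Fin (n + 1)) (Fin (n + 1)) F)ᵀ = 1 := by
  ext i j
  have hi := i.2
  have hj := j.2
  rw [Matrix.mul_apply]
  simp only [deltaMinus_xi]
  rw [Finset.sum_eq_single (⟨n - 1 - i, by omega⟩ : Fin n), if_pos (by simp; omega), one_mul,
    Matrix.one_apply]
  · congr 1
    exact propext ⟨fun h => Fin.ext (by simp at h; omega), fun h => by subst h; simp; omega⟩
  · intro b _ hb
    rw [if_neg, zero_mul]
    intro hb'
    exact hb (Fin.ext (by simp; omega))
  · simp

lemma pow_comm_of (h A : Matrix (Fin n) (Fin n) F) (e : h * A = A * h) (k : ℕ) :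
    h * A ^ k = A ^ k * h := (Commute.pow_right (show Commute h A from e) k)

lemma stab_plus (h : Matrix.GeneralLinearGroup (Fin n) F)
    (X : Matrix (Fin (n + 1)) (Fin (n + 1)) F) (e : act h X = X) :
    (h : Matrix (Fin n) (Fin n) F) * deltaPlus X = deltaPlus X := by
  ext i j
  have h1 : (h : Matrix (Fin n) (Fin n) F) *ᵥ (blockA X ^ (n - 1 - (j : ℕ)) *ᵥ blockU X) =
      blockA X ^ (n - 1 - (j : ℕ)) *ᵥ blockU X := by
    rw [Matrix.mulVec_mulVec, pow_comm_of _ _ (act_A e), ← Matrix.mulVec_mulVec, act_U e]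
  exact congrFun h1 i

lemma stab_minus (h : Matrix.GeneralLinearGroup (Fin n) F)
    (X : Matrix (Fin (n + 1)) (Fin (n + 1)) F) (e : act h X = X) :
    deltaMinus X * (h : Matrix (Fin n) (Fin n) F) = deltaMinus X := by
  ext i j
  have h1 : (blockV X ᵥ* blockA X ^ (i : ℕ)) ᵥ* (h : Matrix (Fin n) (Fin n) F) =
      blockV X ᵥ* blockA X ^ (i : ℕ) := by
    rw [Matrix.vecMul_vecMul, ← pow_comm_of _ _ (act_A e), ← Matrix.vecMul_vecMul, act_V e]
  exact congrFun h1 j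

end Helpers

/-- `ξ₊` and `ξ₋` are regular nilpotent (`Δ₊(ξ₊) = 1`, `Δ₋(ξ₋)` a unit, trivial
stabilizers), but they lie in distinct `GL_n(F)`-orbits. -/
theorem two_regular_orbits (n : ℕ) (hn : 1 ≤ n) (F : Type*) [Field F] :
    invMap (xiPlus n : Matrix (Fin (n + 1)) (Fin (n + 1)) F) = 0 ∧
    invMap ((xiPlus n : Matrix (Fin (n + 1)) (Fin (n + 1)) F)ᵀ) = 0 ∧
    DeltaPlus (xiPlus n : Matrix (Fin (n + 1)) (Fin (n + 1)) F) = 1 ∧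
    IsUnit (DeltaMinus ((xiPlus n : Matrix (Fin (n + 1)) (Fin (n + 1)) F)ᵀ)) ∧
    (∀ h : Matrix.GeneralLinearGroup (Fin n) F, act h (xiPlus n) = xiPlus n → h = 1) ∧
    (∀ h : Matrix.GeneralLinearGroup (Fin n) F, act h ((xiPlus n)ᵀ) = (xiPlus n)ᵀ → h = 1) ∧
    ¬ ∃ h : Matrix.GeneralLinearGroup (Fin n) F, act h (xiPlus n) = (xiPlus n)ᵀ := by
  refine ⟨?_, ?_, ?_, ?_, ?_, ?_, ?_⟩
  · refine Prod.ext ?_ ?_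
    · ext i
      have := i.2
      simp only [invMap, aInv, charpoly_xi, Polynomial.coeff_X_pow]
      rw [if_neg (by omega)]
      simp
    · ext j
      simp [invMap, bInv, blockW_xi, blockV_xi]
  · refine Prod.ext ?_ ?_
    · ext i
      have := i.2
      simp only [invMap, aInv, blockA_transpose, Matrix.charpoly_transpose, charpoly_xi,
        Polynomial.coeff_X_pow]
      rw [if_neg (by omega)]
      simp
    · ext j
      have hw : blockW (xiPlus n : Matrix (Fin (n + 1)) (Fin (n + 1)) F)ᵀ = 0 := blockW_xi
      simp [invMap, bInv, hw, blockU_transpose, blockV_xi]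
  · rw [DeltaPlus, deltaPlus_xi, Matrix.det_one]
  · have h1 := congrArg Matrix.det (deltaMinus_sq (F := F) (n := n))
    rw [Matrix.det_mul, Matrix.det_one] at h1
    exact IsUnit.of_mul_eq_one _ h1
  · intro h e
    have h1 := stab_plus h _ e
    rw [deltaPlus_xi, Matrix.mul_one] at h1
    exact Units.ext h1
  · intro h e
    have h1 := stab_minus h _ e
    have h2 := congrArg
      (fun M => deltaMinus (xiPlus n : Matrix (Fin (n + 1)) (Fin (n + 1)) F)ᵀ * M) h1
    simp only [← Matrix.mul_assoc, deltaMinus_sq, Matrix.one_mul] at h2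
    exact Units.ext h2
  · rintro ⟨h, e⟩
    have h1 := act_U e
    rw [blockU_transpose, blockV_xi] at h1
    have hh : ((h⁻¹ : Matrix.GeneralLinearGroup (Fin n) F) : Matrix (Fin n) (Fin n) F) *
      (h : Matrix (Fin n) (Fin n) F) = 1 := Units.inv_mul h
    have h2 : blockU (xiPlus n : Matrix (Fin (n + 1)) (Fin (n + 1)) F) = 0 := by
      rw [← Matrix.one_mulVec (blockU (xiPlus n : Matrix (Fin (n + 1)) (Fin (n + 1)) F)), ← hh,
        ← Matrix.mulVec_mulVec, h1, Matrix.mulVec_zero]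
    have h3 := pow_xi (F := F) (n := n) 0 ⟨n - 1, by omega⟩
    rw [h2, Matrix.mulVec_zero, if_pos (by simp; omega)] at h3
    exact zero_ne_one h3
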